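/- arXiv:1510.07377 — 2 statements merged into one kernel-verified Lean document; each statement's English description precedes it below -/
import Mathlib

section
/- Let 0 < α < 1 and let φ : [0,T] → ℝ be piecewise continuous. Then ∫₀ᵀ (I^α φ)(t) φ(t) dt ≥ cos(απ/2) ∫₀ᵀ |(I^(α/2) φ)(t)|² dt ≥ 0, where I^β is the Riemann–Liouville fractional integral of order β. -/
open Real MeasureTheory

/-- The Riemann–Liouville fractional integral of order `β`. -/
noncomputable def RLint (β : ℝ) (φ : ℝ → ℝ) (t : ℝ) : ℝ :=
  ∫ s in (0:ℝ)..t, (t - s) ^ (β - 1) / Real.Gamma β * φ s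

/-- The Riemann–Liouville convolution kernel of order `β`, supported on the positive half-line. -/
noncomputable def RLker (β : ℝ) : ℝ → ℝ :=
  (Set.Ioi (0:ℝ)).indicator fun y => y ^ (β - 1) / Real.Gamma β

lemma measurable_RLker (β : ℝ) : Measurable (RLker β) :=
  Measurable.indicator (by fun_prop) measurableSet_Ioi

lemma RLker_nonneg {β : ℝ} (hβ : 0 < β) (y : ℝ) : 0 ≤ RLker β y :=
  Set.indicator_nonneg (fun y (hy : 0 < y) => by have := Real.Gamma_pos_of_pos hβ; positivity) y

lemma integrableOn_rpow_mul_exp_neg_mul_Ioi {a r : ℝ} (ha : 0 < a) (hr : 0 < r) :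
    IntegrableOn (fun t : ℝ => t ^ (a - 1) * rexp (-(r * t))) (Set.Ioi 0) := by
  have h := integrableOn_rpow_mul_exp_neg_mul_rpow (p := 1) (s := a - 1) (by linarith) one_pos hr
  simpa only [Real.rpow_one, neg_mul] using h

/-- A two-parameter form of the beta integral over the half-line. -/
lemma integral_rpow_mul_add_rpow_Ioi {β d : ℝ} (hβ : 0 < β) (hβ2 : β < 1 / 2) (hd : 0 < d) :
    IntegrableOn (fun u : ℝ => u ^ (β - 1) * (u + d) ^ (β - 1)) (Set.Ioi 0) ∧
    ∫ u in Set.Ioi (0:ℝ), u ^ (β - 1) * (u + d) ^ (β - 1) =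
      Real.Gamma β * Real.Gamma (1 - 2 * β) / Real.Gamma (1 - β) * d ^ (2 * β - 1) := by
  set c : ℝ := 1 - β with hc
  have hc0 : 0 < c := by linarith
  have hG : 0 < Real.Gamma c := Real.Gamma_pos_of_pos hc0
  set ν : Measure ℝ := volume.restrict (Set.Ioi 0) with hν
  have hpos : ∀ᵐ y ∂ν, 0 < y := ae_restrict_mem measurableSet_Ioi
  set F : ℝ → ℝ → ℝ := fun y u =>
    y ^ (c - 1) * rexp (-(d * y)) * (u ^ (β - 1) * rexp (-(y * u))) with hF
  have hFu : ∀ y, 0 < y → ∫ u, F y u ∂ν =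
      Real.Gamma β * (y ^ ((1 - 2 * β) - 1) * rexp (-(d * y))) := by
    intro y hy
    simp only [hF, hν]
    rw [integral_const_mul, Real.integral_rpow_mul_exp_neg_mul_Ioi hβ hy,
      show (1 - 2 * β) - 1 = (c - 1) + -β by rw [hc]; ring, Real.rpow_add hy, Real.rpow_neg hy.le,
      one_div, Real.inv_rpow hy.le]
    ring
  have hFi : Integrable (Function.uncurry F) (ν.prod ν) := by
    rw [integrable_prod_iff (by
      apply Measurable.aestronglyMeasurable; simp only [hF]; fun_prop)]
    constructor
    · filter_upwards [hpos] with y hy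
      exact (integrableOn_rpow_mul_exp_neg_mul_Ioi hβ hy).const_mul (y ^ (c - 1) * rexp (-(d * y)))
    · have h := (integrableOn_rpow_mul_exp_neg_mul_Ioi (a := 1 - 2 * β) (by linarith) hd).const_mul
        (Real.Gamma β)
      refine Integrable.congr h ?_
      filter_upwards [hpos] with y hy
      rw [← hFu y hy]
      refine integral_congr_ae ?_
      filter_upwards [hpos] with u hu
      simp only [Function.uncurry, hF]
      rw [Real.norm_of_nonneg (by positivity)]
  have hFy : ∀ u, 0 < u → ∫ y, F y u ∂ν =
      Real.Gamma c * (u ^ (β - 1) * (u + d) ^ (β - 1)) := by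
    intro u hu
    have h : ∀ y, F y u = u ^ (β - 1) * (y ^ (c - 1) * rexp (-((u + d) * y))) := by
      intro y
      simp only [hF]
      rw [show -((u + d) * y) = -(d * y) + -(y * u) by ring, Real.exp_add]
      ring
    simp only [h, hν]
    rw [integral_const_mul, Real.integral_rpow_mul_exp_neg_mul_Ioi hc0 (by positivity),
      show β - 1 = -c by rw [hc]; ring, one_div, Real.inv_rpow (by positivity),
      Real.rpow_neg (x := u + d) (by positivity)]
    ring
  have hae : (fun u => ∫ y, F y u ∂ν) =ᵐ[ν]
      fun u => Real.Gamma c * (u ^ (β - 1) * (u + d) ^ (β - 1)) := by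
    filter_upwards [hpos] with u hu using hFy u hu
  constructor
  · have h := ((hFi.integral_prod_right).congr hae).const_mul (Real.Gamma c)⁻¹
    refine Integrable.congr h (Filter.Eventually.of_forall fun u => ?_)
    simp only
    rw [inv_mul_cancel_left₀ hG.ne']
  · have h := integral_integral_swap hFi
    rw [integral_congr_ae hae, integral_const_mul,
      integral_congr_ae (g := fun y =>
        Real.Gamma β * (y ^ ((1 - 2 * β) - 1) * rexp (-(d * y))))
        (by filter_upwards [hpos] with y hy using hFu y hy), integral_const_mul,
      hν, Real.integral_rpow_mul_exp_neg_mul_Ioi (by linarith) hd, one_div, Real.inv_rpow hd.le,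
      ← Real.rpow_neg hd.le, neg_sub] at h
    rw [div_mul_eq_mul_div, eq_div_iff hG.ne', mul_comm _ (Real.Gamma c), ← h]
    ring

lemma Gamma_one_sub_two_mul_div {β : ℝ} (hβ : 0 < β) (hβ2 : β < 1 / 2) :
    Real.Gamma (1 - 2 * β) / (Real.Gamma (1 - β) * Real.Gamma β) =
      1 / (2 * Real.cos (π * β) * Real.Gamma (2 * β)) := by
  have h1 := Real.Gamma_mul_Gamma_one_sub β
  have h2 := Real.Gamma_mul_Gamma_one_sub (2 * β)
  have hs : 0 < Real.sin (π * β) :=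
    Real.sin_pos_of_pos_of_lt_pi (by positivity) (by nlinarith [Real.pi_pos])
  have hcos : 0 < Real.cos (π * β) :=
    Real.cos_pos_of_mem_Ioo ⟨by nlinarith [Real.pi_pos], by nlinarith [Real.pi_pos]⟩
  have g1 := Real.Gamma_pos_of_pos hβ
  have g2 : 0 < Real.Gamma (1 - β) := Real.Gamma_pos_of_pos (by linarith)
  have g3 : 0 < Real.Gamma (2 * β) := Real.Gamma_pos_of_pos (by linarith)
  rw [show π * (2 * β) = 2 * (π * β) by ring, Real.sin_two_mul, eq_div_iff (by positivity)] at h2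
  rw [eq_div_iff hs.ne'] at h1
  rw [div_eq_div_iff (by positivity) (by positivity)]
  apply mul_right_cancel₀ hs.ne'
  linear_combination h2 - h1

lemma integral_RLker_mul_RLker_of_lt {β s t : ℝ} (hβ : 0 < β) (hβ2 : β < 1 / 2) (hst : s < t) :
    Integrable (fun x => RLker β (x - s) * RLker β (x - t)) ∧
    ∫ x, RLker β (x - s) * RLker β (x - t) =
      |s - t| ^ (2 * β - 1) / (2 * Real.cos (π * β) * Real.Gamma (2 * β)) := by
  have hd : 0 < t - s := sub_pos.2 hst
  obtain ⟨hi, hv⟩ := integral_rpow_mul_add_rpow_Ioi hβ hβ2 hd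
  set G : ℝ → ℝ := (Set.Ioi (0:ℝ)).indicator
    fun u => u ^ (β - 1) * (u + (t - s)) ^ (β - 1) / (Real.Gamma β * Real.Gamma β) with hG
  have hGi : Integrable G := (integrable_indicator_iff measurableSet_Ioi).2 (hi.div_const _)
  have heq : (fun x => RLker β (x - s) * RLker β (x - t)) = fun x => G (x - t) := by
    funext x
    simp only [hG, RLker, Set.indicator_apply, Set.mem_Ioi]
    by_cases h : 0 < x - t
    · rw [if_pos h, if_pos h, if_pos (by linarith), show x - t + (t - s) = x - s by ring]
      ring
    · rw [if_neg h, if_neg h, mul_zero]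
  rw [heq]
  refine ⟨hGi.comp_sub_right t, ?_⟩
  rw [integral_sub_right_eq_self G t, hG, integral_indicator measurableSet_Ioi, integral_div, hv,
    abs_sub_comm, abs_of_pos hd, div_eq_mul_one_div (_ ^ (2 * β - 1)),
    ← Gamma_one_sub_two_mul_div hβ hβ2]
  have g1 := Real.Gamma_pos_of_pos hβ
  have g2 : 0 < Real.Gamma (1 - β) := Real.Gamma_pos_of_pos (by linarith)
  field_simp

lemma integral_RLker_mul_RLker {β s t : ℝ} (hβ : 0 < β) (hβ2 : β < 1 / 2) (hst : s ≠ t) :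
    Integrable (fun x => RLker β (x - s) * RLker β (x - t)) ∧
    ∫ x, RLker β (x - s) * RLker β (x - t) =
      |s - t| ^ (2 * β - 1) / (2 * Real.cos (π * β) * Real.Gamma (2 * β)) := by
  rcases lt_or_gt_of_ne hst with h | h
  · exact integral_RLker_mul_RLker_of_lt hβ hβ2 h
  · have := integral_RLker_mul_RLker_of_lt hβ hβ2 h
    rw [abs_sub_comm]
    simpa only [mul_comm] using this

lemma ae_fst_ne_snd : ∀ᵐ p : ℝ × ℝ, p.1 ≠ p.2 := by
  have h : ∀ᵐ x : ℝ, x ≠ 0 := by simp [ae_iff]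
  filter_upwards [(quasiMeasurePreserving_sub (volume : Measure ℝ) volume).ae h] with p hp
  exact sub_ne_zero.1 hp

lemma locallyIntegrable_abs_rpow {r : ℝ} (hr : -1 < r) :
    LocallyIntegrable fun x : ℝ => |x| ^ r := by
  have h : ∀ a : ℝ, 0 ≤ a → IntegrableOn (fun x : ℝ => |x| ^ r) (Set.Ioc 0 a) := by
    intro a ha
    have := (intervalIntegral.intervalIntegrable_rpow' (a := 0) (b := a) hr).1
    refine this.congr_fun (fun x hx => ?_) measurableSet_Ioc
    simp only [abs_of_pos hx.1]
  have h' : ∀ a : ℝ, 0 ≤ a → IntervalIntegrable (fun x : ℝ => |x| ^ r) volume 0 a := by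
    intro a ha
    exact (intervalIntegrable_iff_integrableOn_Ioc_of_le ha).2 (h a ha)
  intro x
  have ha : 0 ≤ |x| + 1 := by positivity
  have h2 : IntervalIntegrable (fun x : ℝ => |x| ^ r) volume (-(|x| + 1)) 0 := by
    simpa using ((IntervalIntegrable.iff_comp_neg).1 (h' _ ha)).symm
  have h3 := (h2.trans (h' _ ha))
  rw [intervalIntegrable_iff_integrableOn_Ioo_of_le (by linarith)] at h3
  exact ⟨_, Ioo_mem_nhds (by linarith [neg_abs_le x]) (by linarith [le_abs_self x]), h3⟩

/-- Weakly singular double integrals of bounded functions of bounded support converge. -/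
lemma integrable_mul_mul_abs_sub_rpow {ψ : ℝ → ℝ} {M T r : ℝ} (hr : -1 < r) (hψ : Integrable ψ)
    (hM : ∀ t, |ψ t| ≤ M) (hsupp : ∀ t, t ∉ Set.Ioc 0 T → ψ t = 0) :
    Integrable fun p : ℝ × ℝ => ψ p.1 * ψ p.2 * |p.1 - p.2| ^ r := by
  set g : ℝ → ℝ := (Set.Icc (-T) T).indicator fun x => |x| ^ r with hg
  have hgi : Integrable g := (integrable_indicator_iff measurableSet_Icc).2
    ((locallyIntegrable_abs_rpow hr).integrableOn_isCompact isCompact_Icc)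
  have h1 := Integrable.convolution_integrand (ContinuousLinearMap.mul ℝ ℝ) hψ hgi
  have h2 := Integrable.bdd_mul (f := fun p : ℝ × ℝ => ψ p.1) (c := M) h1
    hψ.aestronglyMeasurable.comp_fst (Filter.Eventually.of_forall fun p => hM p.1)
  refine h2.congr (Filter.Eventually.of_forall fun p => ?_)
  simp only [ContinuousLinearMap.mul_apply']
  by_cases hp1 : p.1 ∈ Set.Ioc 0 T
  · by_cases hp2 : p.2 ∈ Set.Ioc 0 T
    · have : p.1 - p.2 ∈ Set.Icc (-T) T :=
        ⟨by linarith [hp1.1, hp2.2], by linarith [hp1.2, hp2.1]⟩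
      rw [hg, Set.indicator_of_mem this]
      ring
    · simp [hsupp _ hp2]
  · simp [hsupp _ hp1]

lemma RLint_eq_integral_RLker {β T t : ℝ} (φ : ℝ → ℝ) (ht : t ∈ Set.Ioc 0 T) :
    RLint β φ t = ∫ s, (Set.Ioc 0 T).indicator φ s * RLker β (t - s) := by
  rw [RLint, intervalIntegral.integral_of_le ht.1.le, ← integral_Ioc_eq_integral_Ioo.symm,
    ← integral_indicator measurableSet_Ioo]
  congr 1
  funext s
  simp only [Set.indicator_apply, RLker, Set.mem_Ioi, Set.mem_Ioo, Set.mem_Ioc, sub_pos]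
  have := ht.2
  by_cases h0 : 0 < s
  · by_cases h1 : s < t
    · rw [if_pos ⟨h0, h1⟩, if_pos ⟨h0, by linarith⟩, if_pos h1, mul_comm]
    · rw [if_neg (fun h => h1 h.2), if_neg h1, mul_zero]
  · rw [if_neg (fun h => h0 h.1), if_neg (fun h => h0 h.1), zero_mul]

lemma RLker_sub_add_RLker_sub {β s t : ℝ} (hst : s ≠ t) :
    RLker β (s - t) + RLker β (t - s) = |s - t| ^ (β - 1) / Real.Gamma β := by
  simp only [RLker, Set.indicator_apply, Set.mem_Ioi, sub_pos]
  rcases lt_or_gt_of_ne hst with h | h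
  · rw [if_neg h.not_gt, if_pos h, abs_sub_comm, abs_of_pos (sub_pos.2 h), zero_add]
  · rw [if_pos h, if_neg h.not_gt, abs_of_pos (sub_pos.2 h), add_zero]

/-- The square of a fractional integral of order `β` over the whole line. -/
lemma integral_sq_convolution_RLker {ψ : ℝ → ℝ} {M T β : ℝ} (hβ : 0 < β) (hβ2 : β < 1 / 2)
    (hψ : Integrable ψ) (hM : ∀ t, |ψ t| ≤ M) (hsupp : ∀ t, t ∉ Set.Ioc 0 T → ψ t = 0) :
    Integrable (fun x => (∫ s, ψ s * RLker β (x - s)) ^ 2) ∧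
    ∫ x, (∫ s, ψ s * RLker β (x - s)) ^ 2 =
      (∫ p : ℝ × ℝ, ψ p.1 * ψ p.2 * |p.1 - p.2| ^ (2 * β - 1)) /
        (2 * Real.cos (π * β) * Real.Gamma (2 * β)) := by
  set C : ℝ := 2 * Real.cos (π * β) * Real.Gamma (2 * β) with hC
  set F : ℝ × ℝ → ℝ → ℝ := fun p x =>
    ψ p.1 * ψ p.2 * (RLker β (x - p.1) * RLker β (x - p.2)) with hF
  have hker := measurable_RLker β
  have hD := integrable_mul_mul_abs_sub_rpow (r := 2 * β - 1) (by linarith) hψ hM hsupp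
  have hψψ : AEStronglyMeasurable (fun p : ℝ × ℝ => ψ p.1 * ψ p.2) :=
    hψ.aestronglyMeasurable.comp_fst.mul hψ.aestronglyMeasurable.comp_snd
  have hFi : Integrable (Function.uncurry F) (volume.prod volume) := by
    have hkk : Measurable fun q : (ℝ × ℝ) × ℝ =>
        RLker β (q.2 - q.1.1) * RLker β (q.2 - q.1.2) := by fun_prop
    have hFm : AEStronglyMeasurable (Function.uncurry F) (volume.prod volume) :=
      hψψ.comp_fst.mul hkk.aestronglyMeasurable
    rw [integrable_prod_iff hFm]
    constructor
    · filter_upwards [ae_fst_ne_snd] with p hp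
      exact (integral_RLker_mul_RLker hβ hβ2 hp).1.const_mul (ψ p.1 * ψ p.2)
    · refine (hD.norm.div_const C).congr ?_
      filter_upwards [ae_fst_ne_snd] with p hp
      have h : ∀ x, ‖Function.uncurry F (p, x)‖ =
          ‖ψ p.1 * ψ p.2‖ * (RLker β (x - p.1) * RLker β (x - p.2)) := by
        intro x
        simp only [Function.uncurry, hF]
        rw [norm_mul, Real.norm_of_nonneg
          (mul_nonneg (RLker_nonneg hβ (x - p.1)) (RLker_nonneg hβ (x - p.2)))]
      simp only [h]
      rw [integral_const_mul, (integral_RLker_mul_RLker hβ hβ2 hp).2, norm_mul _ (_ ^ _),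
        Real.norm_of_nonneg (Real.rpow_nonneg (abs_nonneg (p.1 - p.2)) _), mul_div_assoc]
  have hsq : ∀ x, ∫ p, F p x = (∫ s, ψ s * RLker β (x - s)) ^ 2 := by
    intro x
    rw [sq, ← integral_prod_mul]
    refine integral_congr_ae (Filter.Eventually.of_forall fun p => ?_)
    simp only [hF]
    ring
  refine ⟨?_, ?_⟩
  · simp only [← hsq]
    exact hFi.integral_prod_right
  · simp only [← hsq]
    rw [← integral_integral_swap hFi, ← integral_div]
    refine integral_congr_ae ?_
    filter_upwards [ae_fst_ne_snd] with p hp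
    simp only [hF]
    rw [integral_const_mul, (integral_RLker_mul_RLker hβ hβ2 hp).2, mul_div_assoc]

/-- The quadratic form of the fractional integral, in symmetrised form. -/
lemma integral_mul_convolution_RLker {ψ : ℝ → ℝ} {M T α : ℝ} (hα : 0 < α)
    (hψ : Integrable ψ) (hM : ∀ t, |ψ t| ≤ M) (hsupp : ∀ t, t ∉ Set.Ioc 0 T → ψ t = 0) :
    ∫ t, (∫ s, ψ s * RLker α (t - s)) * ψ t =
      (∫ p : ℝ × ℝ, ψ p.1 * ψ p.2 * |p.1 - p.2| ^ (α - 1)) / (2 * Real.Gamma α) := by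
  have hker := measurable_RLker α
  have hG := Real.Gamma_pos_of_pos hα
  have hD := integrable_mul_mul_abs_sub_rpow (r := α - 1) (by linarith) hψ hM hsupp
  set F : ℝ × ℝ → ℝ := fun p => ψ p.1 * ψ p.2 * RLker α (p.1 - p.2) with hF
  have hadd : ∀ᵐ p : ℝ × ℝ, F p + F p.swap =
      ψ p.1 * ψ p.2 * |p.1 - p.2| ^ (α - 1) / Real.Gamma α := by
    filter_upwards [ae_fst_ne_snd] with p hp
    rw [mul_div_assoc, ← RLker_sub_add_RLker_sub hp]
    simp only [hF, Prod.fst_swap, Prod.snd_swap]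
    ring
  have hFi : Integrable F := by
    refine (hD.div_const (Real.Gamma α)).mono
      ((hψ.aestronglyMeasurable.comp_fst.mul hψ.aestronglyMeasurable.comp_snd).mul
        (Measurable.aestronglyMeasurable (by fun_prop))) ?_
    filter_upwards [ae_fst_ne_snd] with p hp
    rw [mul_div_assoc, ← RLker_sub_add_RLker_sub hp, norm_mul, norm_mul _ (_ + _)]
    have h1 := RLker_nonneg hα (p.1 - p.2)
    have h2 := RLker_nonneg hα (p.2 - p.1)
    rw [Real.norm_of_nonneg h1, Real.norm_of_nonneg (add_nonneg h1 h2)]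
    gcongr
    linarith
  have hswap : ∫ p : ℝ × ℝ, F p.swap = ∫ p, F p := integral_prod_swap F
  have hsum : (∫ p, F p) + ∫ p : ℝ × ℝ, F p.swap =
      (∫ p : ℝ × ℝ, ψ p.1 * ψ p.2 * |p.1 - p.2| ^ (α - 1)) / Real.Gamma α := by
    have hFs : Integrable fun p : ℝ × ℝ => F p.swap := hFi.swap
    rw [← integral_add hFi hFs, ← integral_div]
    exact integral_congr_ae hadd
  have hfub : ∫ t, (∫ s, ψ s * RLker α (t - s)) * ψ t = ∫ p, F p := by
    rw [Measure.volume_eq_prod, integral_prod F hFi]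
    refine integral_congr_ae (Filter.Eventually.of_forall fun t => ?_)
    simp only [hF]
    rw [← integral_mul_const]
    refine integral_congr_ae (Filter.Eventually.of_forall fun s => ?_)
    simp only
    ring
  rw [hfub, mul_comm 2, ← div_div, ← hsum, hswap]
  ring

/-- For `0 < α < 1` and a piecewise continuous `φ : [0,T] → ℝ` (continuous off a
finite set, and bounded),
`∫₀ᵀ (I^α φ)(t) φ(t) dt ≥ cos(απ/2) ∫₀ᵀ |(I^(α/2) φ)(t)|² dt ≥ 0`. -/
theorem stmt6 (α T : ℝ) (hα : 0 < α) (hα1 : α < 1) (hT : 0 < T)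
    (φ : ℝ → ℝ)
    (hpc : ∃ F : Finset ℝ, ContinuousOn φ (Set.Icc 0 T \ (F : Set ℝ)))
    (hbd : ∃ M : ℝ, ∀ t ∈ Set.Icc (0:ℝ) T, |φ t| ≤ M) :
    (∫ t in (0:ℝ)..T, RLint α φ t * φ t) ≥
      Real.cos (α * π / 2) * ∫ t in (0:ℝ)..T, (RLint (α / 2) φ t) ^ 2 ∧
    Real.cos (α * π / 2) * (∫ t in (0:ℝ)..T, (RLint (α / 2) φ t) ^ 2) ≥ 0 := by
  obtain ⟨F, hF⟩ := hpc
  obtain ⟨M, hM⟩ := hbd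
  set ψ : ℝ → ℝ := (Set.Ioc 0 T).indicator φ with hψdef
  have hM0 : 0 ≤ M := (abs_nonneg _).trans (hM 0 ⟨le_rfl, hT.le⟩)
  have hψM : ∀ t, |ψ t| ≤ M := by
    intro t
    by_cases ht : t ∈ Set.Ioc 0 T
    · rw [hψdef, Set.indicator_of_mem ht]
      exact hM t ⟨ht.1.le, ht.2⟩
    · rw [hψdef, Set.indicator_of_notMem ht, abs_zero]
      exact hM0
  have hsupp : ∀ t, t ∉ Set.Ioc 0 T → ψ t = 0 := fun t ht => Set.indicator_of_notMem ht _
  have hmeas : AEStronglyMeasurable φ (volume.restrict (Set.Icc 0 T)) := by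
    have h := hF.aestronglyMeasurable (μ := volume)
      (measurableSet_Icc.diff F.finite_toSet.measurableSet)
    rwa [Measure.restrict_congr_set
      (sdiff_null_ae_eq_self (F.finite_toSet.measure_zero volume))] at h
  have hψ : Integrable ψ := by
    refine (integrable_indicator_iff measurableSet_Ioc).2 ?_
    have h : IntegrableOn φ (Set.Icc 0 T) := by
      refine Integrable.of_bound hmeas M ?_
      filter_upwards [ae_restrict_mem measurableSet_Icc] with t ht using hM t ht
    exact h.mono_set Set.Ioc_subset_Icc_self
  have hcos : 0 < Real.cos (α * π / 2) :=
    Real.cos_pos_of_mem_Ioo ⟨by nlinarith [Real.pi_pos], by nlinarith [Real.pi_pos]⟩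
  obtain ⟨hi, hsq⟩ := integral_sq_convolution_RLker (β := α / 2) (by linarith) (by linarith)
    hψ hψM hsupp
  have hquad := integral_mul_convolution_RLker hα hψ hψM hsupp
  have hle : ∫ t in (0:ℝ)..T, (RLint (α / 2) φ t) ^ 2 ≤
      ∫ x, (∫ s, ψ s * RLker (α / 2) (x - s)) ^ 2 := by
    rw [intervalIntegral.integral_of_le hT.le, setIntegral_congr_fun measurableSet_Ioc
      (fun t ht => by simp only [RLint_eq_integral_RLker φ ht]; rfl)]
    exact setIntegral_le_integral hi (Filter.Eventually.of_forall fun x => sq_nonneg _)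
  have hlhs : ∫ t in (0:ℝ)..T, RLint α φ t * φ t =
      ∫ t, (∫ s, ψ s * RLker α (t - s)) * ψ t := by
    rw [intervalIntegral.integral_of_le hT.le, ← integral_indicator measurableSet_Ioc]
    refine integral_congr_ae (Filter.Eventually.of_forall fun t => ?_)
    by_cases ht : t ∈ Set.Ioc 0 T
    · simp only [Set.indicator_of_mem ht, hψdef, RLint_eq_integral_RLker φ ht]
    · simp only [Set.indicator_of_notMem ht, hψdef, mul_zero]
  constructor
  · refine ge_iff_le.2 ((mul_le_mul_of_nonneg_left hle hcos.le).trans (le_of_eq ?_))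
    rw [hlhs, hquad, hsq, show 2 * (α / 2) = α by ring, show π * (α / 2) = α * π / 2 by ring]
    have hG := Real.Gamma_pos_of_pos hα
    field_simp
  · exact mul_nonneg hcos.le
      (intervalIntegral.integral_nonneg hT.le fun t _ => sq_nonneg _)
end

section
/- Let 0 < α < 1 and let φ ∈ W^{1,1}(0,T). Then ∫₀ᵀ (B^α φ)(t) φ(t) dt ≥ c_α T^(α-1) ∫₀ᵀ |φ(t)|² dt, where c_α = π^(1-α)(1-α)^(1-α)(2-α)^(α-2) sin(απ/2) > 0 and B^α φ = d/dt ∫₀ᵗ ω_α(t-s)φ(s) ds with ω_α(t) = t^(α-1)/Γ(α). -/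
open Real MeasureTheory

theorem intervalIntegral_swap_triangle {r : ℝ} (hr : 0 ≤ r) {F : ℝ → ℝ → ℝ}
    (hF : Integrable (fun p : ℝ × ℝ => if p.2 < p.1 then F p.1 p.2 else 0)
      ((volume.restrict (Set.Ioc 0 r)).prod (volume.restrict (Set.Ioc 0 r)))) :
    ∫ s in (0 : ℝ)..r, ∫ u in (0 : ℝ)..s, F s u = ∫ u in (0 : ℝ)..r, ∫ s in u..r, F s u := by
  have h := integral_integral_swap (f := fun s u => if u < s then F s u else 0) hF
  rw [intervalIntegral.integral_of_le hr, intervalIntegral.integral_of_le hr]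
  refine Eq.trans (setIntegral_congr_fun measurableSet_Ioc fun s hs => ?_)
    (h.trans (setIntegral_congr_fun measurableSet_Ioc fun u hu => ?_))
  · rw [intervalIntegral.integral_of_le hs.1.le, integral_Ioc_eq_integral_Ioo,
      ← integral_indicator measurableSet_Ioo, ← integral_indicator measurableSet_Ioc]
    congr 1 with u
    have := hs.1
    have := hs.2
    simp only [Set.indicator, Set.mem_Ioo, Set.mem_Ioc]
    grind
  · rw [intervalIntegral.integral_of_le hu.2,
      ← integral_indicator measurableSet_Ioc, ← integral_indicator measurableSet_Ioc]
    congr 1 with s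
    have := hu.1
    have := hu.2
    simp only [Set.indicator, Set.mem_Ioc]
    grind

theorem integrable_rpow_sub_mul {a T : ℝ} (ha : 0 < a) (hT : 0 ≤ T) {g : ℝ → ℝ}
    (hg : IntervalIntegrable g volume 0 T) :
    Integrable (fun p : ℝ × ℝ => if p.2 < p.1 then (p.1 - p.2) ^ (a - 1) * g p.2 else 0)
      ((volume.restrict (Set.Ioc 0 T)).prod (volume.restrict (Set.Ioc 0 T))) := by
  have hk : IntervalIntegrable (fun x : ℝ => x ^ (a - 1)) volume 0 T :=
    intervalIntegral.intervalIntegrable_rpow' (by linarith)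
  rw [intervalIntegrable_iff_integrableOn_Ioc_of_le hT] at hg hk
  have hG := hg.integrable_indicator measurableSet_Ioc
  have hK := hk.integrable_indicator measurableSet_Ioc
  have h := hG.convolution_integrand (ContinuousLinearMap.mul ℝ ℝ) hK
  have h2 := h.integrableOn (s := Set.Ioc 0 T ×ˢ Set.Ioc 0 T)
  rw [Measure.prod_restrict]
  refine h2.congr_fun (fun p hp => ?_) (measurableSet_Ioc.prod measurableSet_Ioc)
  obtain ⟨⟨h1, h2⟩, h3, h4⟩ := hp
  simp only [Set.indicator, Set.mem_Ioc, ContinuousLinearMap.mul_apply']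
  rw [mul_comm]
  by_cases h5 : p.2 < p.1
  · rw [if_pos ⟨by linarith, by linarith⟩, if_pos ⟨h3, h4⟩, if_pos h5]
  · rw [if_neg (c := _ ∧ _) (fun h => h5 (by linarith only [h.1])), if_neg h5, zero_mul]

theorem intervalIntegrable_rpow_sub {a T : ℝ} (ha : 0 < a) (c d : ℝ) :
    IntervalIntegrable (fun s : ℝ => (T - s) ^ (a - 1)) volume c d := by
  simpa using (intervalIntegral.intervalIntegrable_rpow' (a := T - c) (b := T - d)
    (r := a - 1) (by linarith)).comp_sub_left T

theorem ae_intervalIntegrable_rpow_sub_mul {a T : ℝ} (ha : 0 < a) (hT : 0 ≤ T) {g : ℝ → ℝ}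
    (hg : IntervalIntegrable g volume 0 T) :
    ∀ᵐ t ∂volume.restrict (Set.Ioc 0 T),
      IntervalIntegrable (fun s => (t - s) ^ (a - 1) * g s) volume 0 t := by
  filter_upwards [(integrable_rpow_sub_mul ha hT hg).prod_right_ae, ae_restrict_mem measurableSet_Ioc]
    with t ht htm
  rw [intervalIntegrable_iff_integrableOn_Ioo_of_le htm.1.le]
  have h : IntegrableOn _ (Set.Ioc 0 T) volume := ht
  refine (h.mono_set (Set.Ioo_subset_Ioc_self.trans (Set.Ioc_subset_Ioc_right htm.2))).congr_fun
    (fun s hs => ?_) measurableSet_Ioo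
  simp [hs.2]

theorem intervalIntegrable_integral_rpow_sub_mul {a T : ℝ} (ha : 0 < a) (hT : 0 ≤ T) {g : ℝ → ℝ}
    (hg : IntervalIntegrable g volume 0 T) :
    IntervalIntegrable (fun t => ∫ s in (0 : ℝ)..t, (t - s) ^ (a - 1) * g s) volume 0 T := by
  rw [intervalIntegrable_iff_integrableOn_Ioc_of_le hT]
  have h : IntegrableOn _ (Set.Ioc 0 T) volume :=
    (integrable_rpow_sub_mul ha hT hg).integral_prod_left
  refine h.congr_fun (fun t ht => ?_) measurableSet_Ioc
  simp only
  symm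
  rw [intervalIntegral.integral_of_le ht.1.le, integral_Ioc_eq_integral_Ioo,
      ← integral_indicator measurableSet_Ioo, ← integral_indicator measurableSet_Ioc]
  congr 1 with u
  have := ht.1
  have := ht.2
  simp only [Set.indicator, Set.mem_Ioo, Set.mem_Ioc]
  grind

theorem integral_rpow_sub_mul_eq {a T c : ℝ} (ha : 0 < a) (hT : 0 ≤ T) {f g : ℝ → ℝ}
    (hg : IntervalIntegrable g volume 0 T)
    (hf : ∀ t ∈ Set.Icc (0 : ℝ) T, f t = c + ∫ s in (0 : ℝ)..t, g s) :
    ∫ s in (0 : ℝ)..T, (T - s) ^ (a - 1) * f s =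
      ∫ t in (0 : ℝ)..T, (c * t ^ (a - 1) + ∫ s in (0 : ℝ)..t, (t - s) ^ (a - 1) * g s) := by
  have hk : IntervalIntegrable (fun x : ℝ => x ^ (a - 1)) volume 0 T :=
    intervalIntegral.intervalIntegrable_rpow' (by linarith)
  have hk' := intervalIntegrable_rpow_sub (T := T) ha 0 T
  have hprod : Integrable (fun p : ℝ × ℝ => if p.2 < p.1 then (T - p.1) ^ (a - 1) * g p.2 else 0)
      ((volume.restrict (Set.Ioc 0 T)).prod (volume.restrict (Set.Ioc 0 T))) := by
    rw [intervalIntegrable_iff_integrableOn_Ioc_of_le hT] at hk' hg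
    have h := (hk'.mul_prod hg).indicator (measurableSet_lt measurable_snd measurable_fst)
    exact h
  have h1 := intervalIntegral_swap_triangle (F := fun s u => (s - u) ^ (a - 1) * g u) hT (integrable_rpow_sub_mul ha hT hg)
  have h2 := intervalIntegral_swap_triangle (F := fun s u => (T - s) ^ (a - 1) * g u) hT hprod
  have h3 : ∀ u, ∫ s in u..T, (T - s) ^ (a - 1) = ∫ s in u..T, (s - u) ^ (a - 1) := by
    intro u
    rw [intervalIntegral.integral_comp_sub_left (fun x => x ^ (a - 1)) T,
      intervalIntegral.integral_comp_sub_right (fun x => x ^ (a - 1)) u]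
    simp
  have h4 : ∫ s in (0 : ℝ)..T, (T - s) ^ (a - 1) * f s =
      ∫ s in (0 : ℝ)..T, (c * (T - s) ^ (a - 1) + ∫ u in (0 : ℝ)..s, (T - s) ^ (a - 1) * g u) := by
    refine intervalIntegral.integral_congr fun s hs => ?_
    rw [Set.uIcc_of_le hT] at hs
    simp only [hf s hs, intervalIntegral.integral_const_mul]
    ring
  have h5 : IntervalIntegrable (fun s => ∫ u in (0 : ℝ)..s, (T - s) ^ (a - 1) * g u)
      volume 0 T := by
    simp only [intervalIntegral.integral_const_mul]
    refine hk'.mul_continuousOn ?_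
    exact intervalIntegral.continuousOn_primitive_interval' hg (by simp)
  rw [h4, intervalIntegral.integral_add (hk'.const_mul c) h5,
    intervalIntegral.integral_add (hk.const_mul c)
      (intervalIntegrable_integral_rpow_sub_mul ha hT hg), h2, h1]
  simp only [intervalIntegral.integral_const_mul, intervalIntegral.integral_mul_const, h3, sub_zero]

theorem rpow_mul_integral_le {a t : ℝ} (ha1 : a < 1) (ht : 0 < t) {f : ℝ → ℝ}
    (hf : IntervalIntegrable f volume 0 t)
    (hkf : IntervalIntegrable (fun s => (t - s) ^ (a - 1) * f s) volume 0 t)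
    (hpos : ∀ x ∈ Set.Icc 0 t, 0 ≤ ∫ s in x..t, f s) :
    t ^ (a - 1) * ∫ s in (0 : ℝ)..t, f s ≤ ∫ s in (0 : ℝ)..t, (t - s) ^ (a - 1) * f s := by
  set ψ : ℝ → ℝ := fun x => (1 - a) * (t - x) ^ (a - 2) with hψ
  have hψ_int : ∀ s ∈ Set.Ico 0 t, IntervalIntegrable ψ volume 0 s := by
    intro s hs
    have := (intervalIntegral.intervalIntegrable_rpow (μ := volume) (a := t - 0) (b := t - s)
      (r := a - 2) (Or.inr (by
        rw [Set.uIcc_of_ge (by linarith [hs.1])]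
        exact fun h => absurd h.1 (by linarith [hs.2])))).comp_sub_left t
    simpa using this.const_mul (1 - a)
  have hψ_eq : ∀ s ∈ Set.Ico 0 t, ∫ x in (0 : ℝ)..s, ψ x = (t - s) ^ (a - 1) - t ^ (a - 1) := by
    intro s hs
    rw [intervalIntegral.integral_const_mul,
      intervalIntegral.integral_comp_sub_left (fun x => x ^ (a - 2)) t,
      integral_rpow (Or.inr ⟨by linarith, ?_⟩)]
    · rw [show a - 2 + 1 = a - 1 by ring, sub_zero]
      have : a - 1 ≠ 0 := by linarith
      field_simp
      ring
    · rw [Set.uIcc_of_le (by linarith [hs.1])]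
      exact fun h => absurd h.1 (by linarith [hs.2])
  have hψ_nonneg : ∀ x ∈ Set.Icc 0 t, 0 ≤ ψ x := fun x hx =>
    mul_nonneg (by linarith) (rpow_nonneg (by linarith [hx.2]) _)
  have hψ_meas : Measurable ψ := by fun_prop
  have hdiff := hkf.sub (hf.const_mul (t ^ (a - 1)))
  have hint : Integrable (fun p : ℝ × ℝ => if p.2 < p.1 then f p.1 * ψ p.2 else 0)
      ((volume.restrict (Set.Ioc 0 t)).prod (volume.restrict (Set.Ioc 0 t))) := by
    have hfm := ((intervalIntegrable_iff_integrableOn_Ioc_of_le ht.le).1 hf).aestronglyMeasurable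
    have hmeas : AEStronglyMeasurable (fun p : ℝ × ℝ => if p.2 < p.1 then f p.1 * ψ p.2 else 0)
        ((volume.restrict (Set.Ioc 0 t)).prod (volume.restrict (Set.Ioc 0 t))) :=
      (hfm.comp_fst.mul (hψ_meas.comp measurable_snd).aestronglyMeasurable).indicator
        (measurableSet_lt measurable_snd measurable_fst)
    have hind : ∀ s ∈ Set.Ico 0 t, ∀ x, (if x < s then f s * ψ x else 0) =
        (Set.Iio s).indicator (fun x => f s * ψ x) x := by
      intro s _ x
      simp [Set.indicator]
    have hinter : ∀ s ∈ Set.Ico 0 t, Set.Iio s ∩ Set.Ioc 0 t = Set.Ioo 0 s := by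
      intro s hs
      ext x
      have := hs.2
      simp only [Set.mem_inter_iff, Set.mem_Iio, Set.mem_Ioc, Set.mem_Ioo]
      grind
    have hae : ∀ᵐ s ∂volume.restrict (Set.Ioc 0 t), s ∈ Set.Ico 0 t := by
      rw [← restrict_Ioo_eq_restrict_Ioc]
      filter_upwards [ae_restrict_mem measurableSet_Ioo] with s hs using ⟨hs.1.le, hs.2⟩
    rw [integrable_prod_iff hmeas]
    constructor
    · filter_upwards [hae] with s hs
      simp only [hind s hs]
      rw [integrable_indicator_iff measurableSet_Iio, IntegrableOn,
        Measure.restrict_restrict measurableSet_Iio, hinter s hs]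
      exact ((intervalIntegrable_iff_integrableOn_Ioo_of_le hs.1).1 (hψ_int s hs)).const_mul _
    · refine (((intervalIntegrable_iff_integrableOn_Ioc_of_le ht.le).1 hdiff).norm).congr ?_
      filter_upwards [hae] with s hs
      simp only [hind s hs, norm_indicator_eq_indicator_norm]
      rw [integral_indicator measurableSet_Iio, Measure.restrict_restrict measurableSet_Iio,
        hinter s hs, ← integral_Ioc_eq_integral_Ioo, ← intervalIntegral.integral_of_le hs.1]
      have h1 : ∫ x in (0 : ℝ)..s, ‖f s * ψ x‖ = ∫ x in (0 : ℝ)..s, ‖f s‖ * ψ x := by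
        refine intervalIntegral.integral_congr fun x hx => ?_
        rw [Set.uIcc_of_le hs.1] at hx
        simp only [norm_mul]
        rw [Real.norm_of_nonneg (hψ_nonneg x ⟨hx.1, hx.2.trans hs.2.le⟩)]
      rw [h1, intervalIntegral.integral_const_mul, hψ_eq s hs, ← sub_mul, norm_mul, mul_comm,
        Real.norm_of_nonneg (r := _ - _)]
      rw [← hψ_eq s hs]
      exact intervalIntegral.integral_nonneg hs.1
        fun x hx => hψ_nonneg x ⟨hx.1, hx.2.trans hs.2.le⟩
  have hswap := intervalIntegral_swap_triangle (F := fun s u => f s * ψ u) ht.le hint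
  have hR : 0 ≤ ∫ u in (0 : ℝ)..t, ∫ s in u..t, f s * ψ u := by
    refine intervalIntegral.integral_nonneg ht.le fun u hu => ?_
    rw [intervalIntegral.integral_mul_const]
    exact mul_nonneg (hpos u hu) (hψ_nonneg u hu)
  have hL : ∫ s in (0 : ℝ)..t, ∫ u in (0 : ℝ)..s, f s * ψ u =
      ∫ s in (0 : ℝ)..t, ((t - s) ^ (a - 1) * f s - t ^ (a - 1) * f s) := by
    rw [intervalIntegral.integral_of_le ht.le, intervalIntegral.integral_of_le ht.le,
      integral_Ioc_eq_integral_Ioo, integral_Ioc_eq_integral_Ioo]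
    refine setIntegral_congr_fun measurableSet_Ioo fun s hs => ?_
    rw [intervalIntegral.integral_const_mul, hψ_eq s ⟨hs.1.le, hs.2⟩]
    ring
  rw [← hswap, hL, intervalIntegral.integral_sub hkf (hf.const_mul _),
    intervalIntegral.integral_const_mul] at hR
  linarith

theorem integral_mul_self_deriv {φ g : ℝ → ℝ} {T c x t : ℝ}
    (hg : IntervalIntegrable g volume 0 T)
    (hφ : ∀ t ∈ Set.Icc (0 : ℝ) T, φ t = c + ∫ s in (0 : ℝ)..t, g s)
    (hx : 0 ≤ x) (hxt : x ≤ t) (ht : t ≤ T) :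
    ∫ s in x..t, φ s * g s = (φ t ^ 2 - φ x ^ 2) / 2 := by
  set Φ : ℝ → ℝ := fun y => c + ∫ s in (0 : ℝ)..y, g s with hΦ
  have hT : 0 ≤ T := hx.trans (hxt.trans ht)
  have hac : AbsolutelyContinuousOnInterval Φ x t := by
    have h1 := hg.absolutelyContinuousOnInterval_intervalIntegral (c := 0) (by simp)
    have h2 : AbsolutelyContinuousOnInterval (fun _ : ℝ => c) 0 T :=
      (LipschitzWith.const c).lipschitzOnWith.absolutelyContinuousOnInterval
    refine (h2.add h1).mono ?_
    rw [Set.uIcc_of_le hT, Set.uIcc_of_le hxt]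
    exact Set.Icc_subset_Icc hx ht
  have h := hac.integral_deriv_mul_eq_sub hac
  rw [hφ t ⟨hx.trans hxt, ht⟩, hφ x ⟨hx, hxt.trans ht⟩]
  have key : ∫ s in x..t, (deriv Φ s * Φ s + Φ s * deriv Φ s) = ∫ s in x..t, 2 * (φ s * g s) := by
    refine intervalIntegral.integral_congr_ae ?_
    filter_upwards [hg.ae_hasDerivAt_integral] with s hs hsx
    rw [Set.uIoc_of_le hxt] at hsx
    have hsT : s ∈ Set.Icc 0 T := ⟨by linarith [hsx.1], by linarith [hsx.2]⟩
    have := (hs (by rwa [Set.uIcc_of_le hT]) 0 (by simp)).const_add c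
    rw [HasDerivAt.deriv this, hφ s hsT]
    ring
  rw [key, intervalIntegral.integral_const_mul] at h
  linarith

theorem pi_rpow_mul_sin_le_two_rpow_div_Gamma {α : ℝ} (hα : 0 < α) (hα1 : α < 1) :
    π ^ (1 - α) * (1 - α) ^ (1 - α) * (2 - α) ^ (α - 2) * sin (α * π / 2) ≤
      2 ^ (1 - α) / Gamma α := by
  have hG : 0 < Gamma α := Gamma_pos_of_pos hα
  have hΓ1 : α * Gamma α ≤ 1 := by
    rw [← Gamma_add_one hα.ne']
    have h := convexOn_Gamma.2 (show (1 : ℝ) ∈ Set.Ioi 0 by simp) (show (2 : ℝ) ∈ Set.Ioi 0 by simp)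
      (show 0 ≤ 1 - α by linarith) hα.le (by ring)
    simp only [smul_eq_mul, Gamma_one, Gamma_two] at h
    convert! h using 2 <;> ring
  have hs1 : sin (α * π / 2) ≤ 1 := sin_le_one _
  have hs2 : sin (α * π / 2) ≤ α * π / 2 := sin_le (by positivity)
  have hs0 : 0 < sin (α * π / 2) :=
    sin_pos_of_pos_of_lt_pi (by positivity) (by nlinarith [pi_pos])
  obtain ⟨b, rfl⟩ : ∃ b, α = 1 - b := ⟨1 - α, by ring⟩
  have hb : 0 < b := by linarith
  have hb1 : b < 1 := by linarith
  rw [le_div_iff₀ hG]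
  have e : (1 - (1 - b)) = b := by ring
  rw [e]
  have e2 : (2 - (1 - b)) ^ ((1 - b) - 2) = ((1 + b) ^ b)⁻¹ * (1 + b)⁻¹ := by
    rw [← rpow_neg (by linarith), ← rpow_neg_one (1 + b), ← rpow_add (by linarith)]
    congr 1 <;> ring
  rw [e2]
  have hpi := pi_pos
  set y := π * b / (2 * (1 + b)) with hy
  have hy0 : 0 < y := by positivity
  have e3 : π ^ b * b ^ b * ((1 + b) ^ b)⁻¹ = 2 ^ b * y ^ b := by
    rw [← inv_rpow (by linarith), ← mul_rpow (by linarith) hb.le,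
      ← mul_rpow (by positivity) (by positivity), ← mul_rpow (by norm_num) hy0.le]
    congr 1
    rw [hy]; field_simp
  have hyb : y ^ b ≤ 1 - b * (1 - y) := by
    have := rpow_one_add_le_one_add_mul_self (s := y - 1) (by linarith) hb.le hb1.le
    rw [show 1 + (y - 1) = y by ring] at this
    linarith
  have hyb0 : 0 ≤ y ^ b := by positivity
  set m := sin ((1 - b) * π / 2) * Gamma (1 - b) with hm
  have hm1 : m * (1 - b) ≤ 1 := by nlinarith
  have hm2 : m ≤ π / 2 := by nlinarith
  have hm0 : 0 < m := by positivity
  have hfin : y ^ b * m ≤ 1 + b := by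
    have hπ1 : π < 3.15 := by linarith [pi_lt_d2]
    have hyy : y * (1 + b) = π / 2 * b := by rw [hy]; field_simp
    have hyu : y * (1 + b) ≤ 1.575 * b := by nlinarith
    by_cases hc : b ≤ 0.48
    · have h1 : y ≤ 1 - b := by
        have : y * (1 + b) ≤ (1 - b) * (1 + b) := by nlinarith
        exact le_of_mul_le_mul_right this (by linarith)
      have h2 : y ^ b ≤ (1 - b) * (1 + b) := by nlinarith
      calc y ^ b * m ≤ (1 - b) * (1 + b) * m := by gcongr
        _ = m * (1 - b) * (1 + b) := by ring
        _ ≤ 1 * (1 + b) := by gcongr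
        _ = 1 + b := one_mul _
    · push Not at hc
      have h1 : y ≤ 0.7875 := by
        have : y * (1 + b) ≤ 0.7875 * (1 + b) := by nlinarith
        exact le_of_mul_le_mul_right this (by linarith)
      have h2 : y ^ b ≤ 1 - 0.2125 * b := by nlinarith
      calc y ^ b * m ≤ (1 - 0.2125 * b) * 1.575 := by
            gcongr
            · linarith
            · linarith
        _ ≤ 1 + b := by linarith
  calc _ = (π ^ b * b ^ b * ((1 + b) ^ b)⁻¹) * (1 + b)⁻¹ * m := by rw [hm]; ring
    _ = 2 ^ b * ((y ^ b * m) * (1 + b)⁻¹) := by rw [e3]; ring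
    _ ≤ 2 ^ b * 1 := by
      gcongr
      rw [← div_eq_mul_inv, div_le_one (by linarith)]
      exact hfin
    _ = 2 ^ b := mul_one _

theorem le_mul_integral_rpow_sub {a t T : ℝ} (ha1 : a < 1) {φ g : ℝ → ℝ}
    (hg : IntervalIntegrable g volume 0 T)
    (hφ : ∀ t ∈ Set.Icc (0 : ℝ) T, φ t = φ 0 + ∫ s in (0 : ℝ)..t, g s)
    (ht : 0 < t) (htT : t ≤ T)
    (hk : IntervalIntegrable (fun s => (t - s) ^ (a - 1) * g s) volume 0 t)
    (hk2 : IntervalIntegrable (fun s => (t - s) ^ (a - 1) * (2 * (φ s * g s))) volume 0 t) :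
    (φ 0 ^ 2 * t ^ (a - 1) + ∫ s in (0 : ℝ)..t, (t - s) ^ (a - 1) * (2 * (φ s * g s))) / 2 +
        t ^ (a - 1) * φ t ^ 2 / 2 ≤
      (φ 0 * t ^ (a - 1) + ∫ s in (0 : ℝ)..t, (t - s) ^ (a - 1) * g s) * φ t := by
  have hgt : IntervalIntegrable g volume 0 t :=
    hg.mono_set (by
      rw [Set.uIcc_of_le ht.le, Set.uIcc_of_le (ht.le.trans htT)]
      exact Set.Icc_subset_Icc_right htT)
  have hφc : ContinuousOn φ (Set.uIcc 0 t) := by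
    refine ContinuousOn.congr (f := fun y => φ 0 + ∫ s in (0 : ℝ)..y, g s)
      (continuousOn_const.add
        (intervalIntegral.continuousOn_primitive_interval' hgt (by simp))) fun s hs => ?_
    rw [Set.uIcc_of_le ht.le] at hs
    exact hφ s ⟨hs.1, hs.2.trans htT⟩
  have hφg : IntervalIntegrable (fun s => φ s * g s) volume 0 t := hgt.continuousOn_mul hφc
  have hf : IntervalIntegrable (fun s => φ t * g s - φ s * g s) volume 0 t :=
    (hgt.const_mul (φ t)).sub hφg
  have hval : ∀ x ∈ Set.Icc 0 t,
      ∫ s in x..t, (φ t * g s - φ s * g s) = (φ t - φ x) ^ 2 / 2 := by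
    intro x hx
    have hsub : Set.uIcc x t ⊆ Set.uIcc 0 t := by
      rw [Set.uIcc_of_le ht.le, Set.uIcc_of_le hx.2]
      exact Set.Icc_subset_Icc_left hx.1
    rw [intervalIntegral.integral_sub ((hgt.mono_set hsub).const_mul _) (hφg.mono_set hsub),
      intervalIntegral.integral_const_mul, integral_mul_self_deriv hg hφ hx.1 hx.2 htT,
      ← intervalIntegral.integral_interval_sub_left hgt (hgt.mono_set (by
        rw [Set.uIcc_of_le ht.le, Set.uIcc_of_le hx.1]
        exact Set.Icc_subset_Icc_right hx.2))]
    have h1 := hφ t ⟨ht.le, htT⟩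
    have h2 := hφ x ⟨hx.1, hx.2.trans htT⟩
    rw [show (∫ s in (0 : ℝ)..t, g s) = φ t - φ 0 by linarith,
      show (∫ s in (0 : ℝ)..x, g s) = φ x - φ 0 by linarith]
    ring
  have hrw : (fun s => (t - s) ^ (a - 1) * (φ t * g s - φ s * g s)) = fun s =>
      φ t * ((t - s) ^ (a - 1) * g s) - 1 / 2 * ((t - s) ^ (a - 1) * (2 * (φ s * g s))) := by
    ext s
    ring
  have hkf := (hk.const_mul (φ t)).sub (hk2.const_mul (1 / 2))
  have h := rpow_mul_integral_le ha1 ht hf (by rw [hrw]; exact hkf) fun x hx => by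
    rw [hval x hx]
    positivity
  rw [hrw, intervalIntegral.integral_sub (hk.const_mul _) (hk2.const_mul _),
    intervalIntegral.integral_const_mul, intervalIntegral.integral_const_mul,
    hval 0 ⟨le_rfl, ht.le⟩] at h
  linarith

theorem two_rpow_mul_add_rpow_le {a x y : ℝ} (ha1 : a < 1) (hx : 0 < x) (hy : 0 < y) :
    2 ^ (1 - a) * (x + y) ^ (a - 1) ≤ (x ^ (a - 1) + y ^ (a - 1)) / 2 := by
  have h1 : 2 ^ (1 - a) * (x + y) ^ (a - 1) = ((x + y) / 2) ^ (a - 1) := by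
    rw [div_rpow (by positivity) (by norm_num), div_eq_mul_inv, ← rpow_neg (by norm_num),
      mul_comm]
    congr 2
    ring
  have h2 : ((x + y) / 2) ^ (a - 1) = (((x + y) / 2) ^ 2) ^ ((a - 1) / 2) := by
    rw [← rpow_natCast, ← rpow_mul (by positivity)]
    congr 1
    push_cast
    ring
  have h3 : (((x + y) / 2) ^ 2) ^ ((a - 1) / 2) ≤ (x * y) ^ ((a - 1) / 2) :=
    rpow_le_rpow_of_nonpos (by positivity) (by nlinarith [sq_nonneg (x - y)]) (by linarith)
  have h4 : ∀ z : ℝ, 0 < z → z ^ (a - 1) = (z ^ ((a - 1) / 2)) ^ 2 := by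
    intro z hz
    rw [← rpow_natCast, ← rpow_mul hz.le]
    congr 1
    push_cast
    ring
  rw [h1, h2, h4 x hx, h4 y hy]
  rw [mul_rpow hx.le hy.le] at h3
  nlinarith [two_mul_le_add_sq (x ^ ((a - 1) / 2)) (y ^ ((a - 1) / 2))]

theorem integral_rpow_mul_sq_le {a T : ℝ} (ha : 0 < a) (ha1 : a < 1) (hT : 0 < T) {φ g : ℝ → ℝ}
    (hg : IntervalIntegrable g volume 0 T)
    (hφ : ∀ t ∈ Set.Icc (0 : ℝ) T, φ t = φ 0 + ∫ s in (0 : ℝ)..t, g s) :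
    2 ^ (1 - a) * T ^ (a - 1) * ∫ t in (0 : ℝ)..T, φ t ^ 2 ≤
      ∫ t in (0 : ℝ)..T,
        (φ 0 * t ^ (a - 1) + ∫ s in (0 : ℝ)..t, (t - s) ^ (a - 1) * g s) * φ t := by
  have hk : IntervalIntegrable (fun x : ℝ => x ^ (a - 1)) volume 0 T :=
    intervalIntegral.intervalIntegrable_rpow' (by linarith)
  have hk' := intervalIntegrable_rpow_sub (T := T) ha 0 T
  have hφc : ContinuousOn φ (Set.uIcc 0 T) := by
    refine ContinuousOn.congr (f := fun y => φ 0 + ∫ s in (0 : ℝ)..y, g s)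
      (continuousOn_const.add
        (intervalIntegral.continuousOn_primitive_interval' hg (by simp))) fun s hs => ?_
    rw [Set.uIcc_of_le hT.le] at hs
    exact hφ s hs
  have hφg : IntervalIntegrable (fun s => 2 * (φ s * g s)) volume 0 T :=
    (hg.continuousOn_mul hφc).const_mul 2
  have hsq : ∀ t ∈ Set.Icc (0 : ℝ) T,
      φ t ^ 2 = φ 0 ^ 2 + ∫ s in (0 : ℝ)..t, 2 * (φ s * g s) := by
    intro t ht
    rw [intervalIntegral.integral_const_mul, integral_mul_self_deriv hg hφ le_rfl ht.1 ht.2]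
    ring
  have hsqc : ContinuousOn (fun s => φ s ^ 2) (Set.uIcc 0 T) := hφc.pow 2
  have hi1 := (hk.const_mul (φ 0 ^ 2)).add (intervalIntegrable_integral_rpow_sub_mul ha hT.le hφg)
  have hi2 := hk.mul_continuousOn hsqc
  have hi3 := hk'.mul_continuousOn hsqc
  have hi4 := ((hk.const_mul (φ 0)).add
    (intervalIntegrable_integral_rpow_sub_mul ha hT.le hg)).mul_continuousOn hφc
  calc 2 ^ (1 - a) * T ^ (a - 1) * ∫ t in (0 : ℝ)..T, φ t ^ 2
      = ∫ t in (0 : ℝ)..T, 2 ^ (1 - a) * T ^ (a - 1) * φ t ^ 2 := by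
        rw [intervalIntegral.integral_const_mul]
    _ ≤ ∫ t in (0 : ℝ)..T,
          ((T - t) ^ (a - 1) * φ t ^ 2 / 2 + t ^ (a - 1) * φ t ^ 2 / 2) := by
        refine intervalIntegral.integral_mono_on_of_le_Ioo hT.le
          (hsqc.intervalIntegrable.const_mul _) ((hi3.div_const 2).add (hi2.div_const 2))
          fun t ht => ?_
        have := two_rpow_mul_add_rpow_le ha1 (sub_pos.2 ht.2) ht.1
        rw [sub_add_cancel] at this
        nlinarith [mul_le_mul_of_nonneg_right this (sq_nonneg (φ t))]
    _ = ∫ t in (0 : ℝ)..T, ((φ 0 ^ 2 * t ^ (a - 1) +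
          ∫ s in (0 : ℝ)..t, (t - s) ^ (a - 1) * (2 * (φ s * g s))) / 2 +
          t ^ (a - 1) * φ t ^ 2 / 2) := by
        rw [intervalIntegral.integral_add (hi3.div_const 2) (hi2.div_const 2),
          intervalIntegral.integral_add (hi1.div_const 2) (hi2.div_const 2),
          intervalIntegral.integral_div, intervalIntegral.integral_div,
          intervalIntegral.integral_div, integral_rpow_sub_mul_eq ha hT.le hφg hsq]
    _ ≤ _ := by
        refine intervalIntegral.integral_mono_ae_restrict hT.le
          ((hi1.div_const 2).add (hi2.div_const 2)) hi4 ?_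
        rw [← restrict_Ioc_eq_restrict_Icc]
        filter_upwards [ae_intervalIntegrable_rpow_sub_mul ha hT.le hg,
          ae_intervalIntegrable_rpow_sub_mul ha hT.le hφg, ae_restrict_mem measurableSet_Ioc]
          with t h1 h2 ht
        exact le_mul_integral_rpow_sub ha1 hg hφ ht.1 ht.2 h1 h2

theorem ae_deriv_integral_rpow_sub {a T C : ℝ} (ha : 0 < a) (hT : 0 < T) {φ g : ℝ → ℝ}
    (hg : IntervalIntegrable g volume 0 T)
    (hφ : ∀ t ∈ Set.Icc (0 : ℝ) T, φ t = φ 0 + ∫ s in (0 : ℝ)..t, g s) :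
    ∀ᵐ t, t ∈ Set.Ioo 0 T →
      deriv (fun r => ∫ s in (0 : ℝ)..r, (r - s) ^ (a - 1) / C * φ s) t =
        (φ 0 * t ^ (a - 1) + ∫ s in (0 : ℝ)..t, (t - s) ^ (a - 1) * g s) / C := by
  have hk : IntervalIntegrable (fun x : ℝ => x ^ (a - 1)) volume 0 T :=
    intervalIntegral.intervalIntegrable_rpow' (by linarith)
  have hi := (hk.const_mul (φ 0)).add (intervalIntegrable_integral_rpow_sub_mul ha hT.le hg)
  filter_upwards [hi.ae_hasDerivAt_integral] with t ht htm
  rw [Set.uIcc_of_le hT.le] at ht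
  have h := (ht ⟨htm.1.le, htm.2.le⟩ 0 ⟨le_rfl, hT.le⟩).div_const C
  refine (h.congr_of_eventuallyEq ?_).deriv
  filter_upwards [Ioo_mem_nhds htm.1 htm.2] with r hr
  rw [← integral_rpow_sub_mul_eq ha hr.1.le (hg.mono_set (by
      rw [Set.uIcc_of_le hr.1.le, Set.uIcc_of_le hT.le]
      exact Set.Icc_subset_Icc_right hr.2.le))
    (fun s hs => hφ s ⟨hs.1, hs.2.trans hr.2.le⟩), ← intervalIntegral.integral_div]
  congr 1 with s
  ring

/-- For `0 < α < 1` and `φ ∈ W^{1,1}(0,T)` (absolutely continuous with integrable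
derivative `g`), the Riemann–Liouville fractional derivative
`B^α φ = d/dt ∫₀ᵗ ω_α(t-s) φ(s) ds` with `ω_α(t) = t^(α-1)/Γ(α)` satisfies
`∫₀ᵀ (B^α φ)(t) φ(t) dt ≥ c_α T^(α-1) ∫₀ᵀ |φ(t)|² dt`, where
`c_α = π^(1-α)(1-α)^(1-α)(2-α)^(α-2) sin(απ/2) > 0`. -/
theorem stmt7 (α T : ℝ) (hα : 0 < α) (hα1 : α < 1) (hT : 0 < T)
    (φ g : ℝ → ℝ) (hg : IntervalIntegrable g MeasureTheory.volume 0 T)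
    (hφ : ∀ t ∈ Set.Icc (0:ℝ) T, φ t = φ 0 + ∫ s in (0:ℝ)..t, g s) :
    (∫ t in (0:ℝ)..T,
        (deriv (fun r => ∫ s in (0:ℝ)..r, (r - s) ^ (α - 1) / Real.Gamma α * φ s) t) * φ t) ≥
      (π ^ (1 - α) * (1 - α) ^ (1 - α) * (2 - α) ^ (α - 2) * Real.sin (α * π / 2)) *
        T ^ (α - 1) * ∫ t in (0:ℝ)..T, |φ t| ^ 2 := by
  have hΓ : 0 < Gamma α := Gamma_pos_of_pos hα
  have hI : 0 ≤ ∫ t in (0:ℝ)..T, φ t ^ 2 :=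
    intervalIntegral.integral_nonneg hT.le fun t _ => sq_nonneg _
  have hT' : 0 ≤ T ^ (α - 1) := rpow_nonneg hT.le _
  have hcongr : (∫ t in (0:ℝ)..T,
        (deriv (fun r => ∫ s in (0:ℝ)..r, (r - s) ^ (α - 1) / Real.Gamma α * φ s) t) * φ t) =
      (∫ t in (0 : ℝ)..T,
        (φ 0 * t ^ (α - 1) + ∫ s in (0 : ℝ)..t, (t - s) ^ (α - 1) * g s) * φ t) / Gamma α := by
    rw [← intervalIntegral.integral_div, intervalIntegral.integral_of_le hT.le,
      intervalIntegral.integral_of_le hT.le, integral_Ioc_eq_integral_Ioo,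
      integral_Ioc_eq_integral_Ioo]
    refine setIntegral_congr_ae measurableSet_Ioo ?_
    filter_upwards [ae_deriv_integral_rpow_sub (C := Gamma α) hα hT hg hφ] with t ht htm
    rw [ht htm]
    ring
  simp only [sq_abs]
  rw [hcongr, ge_iff_le]
  calc _ ≤ 2 ^ (1 - α) / Gamma α * T ^ (α - 1) * ∫ t in (0:ℝ)..T, φ t ^ 2 := by
        gcongr
        exact pi_rpow_mul_sin_le_two_rpow_div_Gamma hα hα1
    _ = (2 ^ (1 - α) * T ^ (α - 1) * ∫ t in (0:ℝ)..T, φ t ^ 2) / Gamma α := by ring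
    _ ≤ _ := by
        gcongr
        exact integral_rpow_mul_sq_le hα hα1 hT hg hφ
end
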